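/- Let ξ > 1 be real and let z = u + iv be a complex number with u < 0 and u < v < 0 (so φ := arg z lies in (−π, −3π/4)). Then the phase θ(z) = ξ(z − z⁻¹) − (1/2)(z² − z⁻²) satisfies Re(2iθ(z)) ≥ |v|·sin(2φ), and sin(2φ) > 0. -/

import Mathlib

/-- The phase function of the defocusing NLS Riemann–Hilbert problem:
`θ(z) = ξ(z − z⁻¹) − (1/2)(z² − z⁻²)`. -/
noncomputable def theta (ξ : ℝ) (z : ℂ) : ℂ :=
  (ξ : ℂ) * (z - z⁻¹) - (1 / 2) * (z ^ 2 - (z⁻¹) ^ 2)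

theorem re_two_I_mul_theta (ξ : ℝ) (z : ℂ) :
    (2 * Complex.I * theta ξ z).re =
      -2 * ξ * z.im * (1 + (Complex.normSq z)⁻¹) +
        2 * (z.re * z.im) * (1 + (Complex.normSq z)⁻¹ ^ 2) := by
  simp only [theta, pow_two, Complex.mul_re, Complex.mul_im, Complex.sub_re, Complex.sub_im,
    Complex.inv_re, Complex.inv_im, Complex.I_re, Complex.I_im, Complex.ofReal_re,
    Complex.ofReal_im, Complex.re_ofNat, Complex.im_ofNat, Complex.div_ofNat_re,
    Complex.div_ofNat_im, Complex.one_re, Complex.one_im]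
  ring

theorem stmt_14 (ξ : ℝ) (hξ : 1 < ξ) (z : ℂ)
    (hu : z.re < 0) (huv : z.re < z.im) (hv : z.im < 0) :
    0 < Real.sin (2 * Complex.arg z) ∧
    |z.im| * Real.sin (2 * Complex.arg z) ≤ (2 * Complex.I * theta ξ z).re := by
  have hz : z ≠ 0 := fun h => by simp [h] at hu
  have hp : 0 < z.re * z.im := mul_pos_of_neg_of_neg hu hv
  have hn : 0 < ‖z‖ := norm_pos_iff.mpr hz
  constructor
  · rw [Real.sin_two_mul, Complex.sin_arg, Complex.cos_arg hz, mul_assoc]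
    exact mul_pos two_pos (mul_pos_of_neg_of_neg (div_neg_of_neg_of_pos hv hn)
      (div_neg_of_neg_of_pos hu hn))
  · have hN : 0 < (Complex.normSq z)⁻¹ := inv_pos.mpr (Complex.normSq_pos.mpr hz)
    calc |z.im| * Real.sin (2 * Complex.arg z)
        ≤ |z.im| * 1 := by gcongr; exact Real.sin_le_one _
      _ = -z.im := by rw [mul_one, abs_of_neg hv]
      _ ≤ -2 * ξ * z.im := by nlinarith
      _ ≤ -2 * ξ * z.im * (1 + (Complex.normSq z)⁻¹) :=
          le_mul_of_one_le_right (by nlinarith) (by linarith)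
      _ ≤ (2 * Complex.I * theta ξ z).re := by
          rw [re_two_I_mul_theta]
          exact le_add_of_nonneg_right (by positivity)
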